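/- arXiv:1307.7176 — 8 statements merged into one kernel-verified Lean document; each statement's English description precedes it below -/
import Mathlib

section
/- Let M ≥ 2 and let x : ZMod (4M−3) → ℂ satisfy x[p] = 0 for all p = M, …, 4M−4 (i.e., x is supported on indices 0, …, M−1). Then for every p = 1, …, 2M−2, the circular autocorrelation satisfies CirAut(x + Rx)[p] = 2·Re⟨x, T^p x⟩ + ⟨x, R T^{−p} x⟩, where ⟨u,v⟩ = Σ_{p'∈ZMod(4M−3)} u[p']·conj(v[p']). -/
open Complex Finset

/-- Circular autocorrelation of a signal `u : ZMod P → ℂ`: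
`CirAut(u)[p] = ∑_{p'} u[p'] · conj(u[p'-p])`. -/
noncomputable def cirAut {P : ℕ} [NeZero P] (u : ZMod P → ℂ) (p : ZMod P) : ℂ :=
  ∑ p' : ZMod P, u p' * (starRingEnd ℂ) (u (p' - p))

/-- Reversal operator: `(Ru)[p] = u[-p]`. -/
def rev {P : ℕ} (u : ZMod P → ℂ) : ZMod P → ℂ := fun p => u (-p)

/-- Translation operator: `(T^p u)[p'] = u[p' - p]`. -/
def transl {P : ℕ} (p : ZMod P) (u : ZMod P → ℂ) : ZMod P → ℂ := fun p' => u (p' - p)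

/-- Inner product of signals: `⟨u,v⟩ = ∑_{p'} u[p'] · conj(v[p'])`. -/
noncomputable def sig_inner {P : ℕ} [NeZero P] (u v : ZMod P → ℂ) : ℂ :=
  ∑ p' : ZMod P, u p' * (starRingEnd ℂ) (v p')

/-- The autocorrelation of a sum with a reversal splits into four correlations. -/
theorem cirAut_add_rev {P : ℕ} [NeZero P] (u : ZMod P → ℂ) (p : ZMod P) :
    cirAut (u + rev u) p =
      2 * ((sig_inner u (transl p u)).re : ℂ) + sig_inner u (rev (transl (-p) u)) +
        ∑ q : ZMod P, u q * (starRingEnd ℂ) (u (-q - p)) := by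
  have hconj : (starRingEnd ℂ) (sig_inner u (transl p u)) =
      ∑ q : ZMod P, u (-q) * (starRingEnd ℂ) (u (p - q)) := by
    unfold sig_inner transl
    rw [map_sum]
    refine Fintype.sum_equiv (Equiv.subLeft p) _ _ fun q => ?_
    simp [mul_comm]
  have hneg : ∑ q : ZMod P, u q * (starRingEnd ℂ) (u (-q - p)) =
      ∑ q : ZMod P, u (-q) * (starRingEnd ℂ) (u (q - p)) :=
    Fintype.sum_equiv (Equiv.neg _) _ _ fun q => by simp
  have hre : (2 * ((sig_inner u (transl p u)).re : ℂ)) =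
      sig_inner u (transl p u) + (starRingEnd ℂ) (sig_inner u (transl p u)) := by
    rw [Complex.add_conj]
    push_cast
    ring
  rw [hre, hconj, hneg]
  simp only [cirAut, sig_inner, rev, transl, Pi.add_apply, ← Finset.sum_add_distrib]
  refine Finset.sum_congr rfl fun q _ => ?_
  rw [map_add, neg_sub, show -q - -p = p - q by ring]
  ring

/-- If a signal is supported on residues below `M` and `p + 2 * (M - 1) < P`, then it does not
overlap its reversal translated by `-p`. -/
theorem mul_conj_neg_sub_eq_zero {P M p : ℕ} [NeZero P] (u : ZMod P → ℂ)
    (hu : ∀ q : ZMod P, M ≤ q.val → u q = 0) (hp : 1 ≤ p) (hpP : p + 2 * (M - 1) < P)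
    (q : ZMod P) : u q * (starRingEnd ℂ) (u (-q - p)) = 0 := by
  by_cases hq : M ≤ q.val
  · rw [hu q hq, zero_mul]
  by_cases hr : M ≤ (-q - (p : ZMod P)).val
  · rw [hu _ hr, map_zero, mul_zero]
  exfalso
  have hsum : ((q.val + (-q - (p : ZMod P)).val + p : ℕ) : ZMod P) = 0 := by
    push_cast
    simp only [ZMod.natCast_val, ZMod.cast_id', id_eq]
    ring
  have hle := Nat.le_of_dvd (by omega) ((ZMod.natCast_eq_zero_iff _ _).1 hsum)
  omega

theorem cirAut_reduction (M : ℕ) (hM : 2 ≤ M) [NeZero (4*M-3)]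
    (x : ZMod (4*M-3) → ℂ)
    (hsupp : ∀ p : ℕ, M ≤ p → p ≤ 4*M-4 → x (p : ZMod (4*M-3)) = 0) :
    ∀ p : ℕ, 1 ≤ p → p ≤ 2*M-2 →
      cirAut (x + rev x) ((p : ZMod (4*M-3))) =
        2 * ((sig_inner x (transl ((p : ZMod (4*M-3))) x)).re : ℂ)
          + sig_inner x (rev (transl (-((p : ZMod (4*M-3)))) x)) := by
  intro p hp hp'
  have hu : ∀ q : ZMod (4*M-3), M ≤ q.val → x q = 0 := fun q hq => by
    have hlt := ZMod.val_lt q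
    simpa using hsupp q.val hq (by omega)
  rw [cirAut_add_rev, Finset.sum_eq_zero fun q _ =>
    mul_conj_neg_sub_eq_zero x hu hp (by omega) q, add_zero]
end

section
/- Let M ≥ 2 and let x : ZMod (4M−3) → ℂ be a nonzero signal satisfying x[p] = 0 for all p = M, …, 4M−4, and let q ∈ {0, …, M−1} be the largest index with x[q] ≠ 0. Then among the entries {CirAut(x+Rx)[p]}_{p=0}^{2M−2}, the last nonzero entry has index p = 2q; that is, CirAut(x+Rx)[2q] ≠ 0 and CirAut(x+Rx)[p] = 0 for all p with 2q < p ≤ 2M−2. -/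
open Complex Finset

theorem rev_add_self_ne_zero_lift {P : ℕ} {x : ZMod P → ℂ} {q : ℕ}
    (hx : ∀ a, x a ≠ 0 → ∃ k : ℕ, k ≤ q ∧ a = (k : ZMod P)) {a : ZMod P}
    (ha : (x + rev x) a ≠ 0) : ∃ i : ℤ, -(q : ℤ) ≤ i ∧ i ≤ q ∧ a = (i : ZMod P) := by
  by_cases h : x a = 0
  · have h' : x (-a) ≠ 0 := by simpa [rev, h] using ha
    obtain ⟨k, hk, hak⟩ := hx _ h'
    exact ⟨-k, by omega, by omega, by push_cast; rw [← hak, neg_neg]⟩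
  · obtain ⟨k, hk, hak⟩ := hx _ h
    exact ⟨k, by omega, by omega, by simpa using hak⟩

theorem exists_int_of_cirAut_term_ne_zero {P : ℕ} {y : ZMod P → ℂ} {q p : ℕ}
    (hy : ∀ a, y a ≠ 0 → ∃ i : ℤ, -(q : ℤ) ≤ i ∧ i ≤ q ∧ a = (i : ZMod P))
    (hp : 2 * q ≤ p) (hpP : p + 2 * q < P) {a : ZMod P}
    (ha : y a * (starRingEnd ℂ) (y (a - (p : ZMod P))) ≠ 0) :
    p = 2 * q ∧ a = (q : ZMod P) := by
  obtain ⟨i, hi, hi', hai⟩ := hy a (left_ne_zero_of_mul ha)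
  obtain ⟨j, hj, hj', haj⟩ := hy (a - p) (by simpa using right_ne_zero_of_mul ha)
  have hz : ((p - (i - j) : ℤ) : ZMod P) = 0 := by
    push_cast
    rw [← hai, ← haj]
    ring
  have hz' : (p - (i - j) : ℤ) = 0 :=
    Int.eq_zero_of_dvd_of_nonneg_of_lt (by omega) (by omega)
      ((ZMod.intCast_zmod_eq_zero_iff_dvd _ _).1 hz)
  have hiq : i = q := by omega
  exact ⟨by omega, by simpa [hiq] using hai⟩

theorem cirAut_last_nonzero_entry (M : ℕ) (hM : 2 ≤ M) [NeZero (4*M-3)]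
    (x : ZMod (4*M-3) → ℂ)
    (hsupp : ∀ p : ℕ, M ≤ p → p ≤ 4*M-4 → x (p : ZMod (4*M-3)) = 0)
    (q : ℕ) (hq : q ≤ M-1) (hxq : x (q : ZMod (4*M-3)) ≠ 0)
    (hlast : ∀ k : ℕ, q < k → k ≤ M-1 → x (k : ZMod (4*M-3)) = 0) :
    cirAut (x + rev x) ((2*q : ℕ) : ZMod (4*M-3)) ≠ 0 ∧
      ∀ p : ℕ, 2*q < p → p ≤ 2*M-2 → cirAut (x + rev x) ((p : ZMod (4*M-3))) = 0 := by
  have hx : ∀ a, x a ≠ 0 → ∃ k : ℕ, k ≤ q ∧ a = (k : ZMod (4*M-3)) := by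
    intro a ha
    refine ⟨a.val, ?_, (ZMod.natCast_zmod_val a).symm⟩
    have hlt := a.val_lt
    by_contra! hk
    refine ha ?_
    rw [← ZMod.natCast_zmod_val a]
    rcases le_or_gt M a.val with h | h
    · exact hsupp _ h (by omega)
    · exact hlast _ hk (by omega)
  have hy := fun a => rev_add_self_ne_zero_lift hx (a := a)
  refine ⟨?_, fun p hp hpM => ?_⟩
  · have hsum : cirAut (x + rev x) ((2*q : ℕ) : ZMod (4*M-3)) =
        (x + rev x) q * (starRingEnd ℂ) ((x + rev x) (q - ((2*q : ℕ) : ZMod (4*M-3)))) := by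
      refine Finset.sum_eq_single _ (fun a _ ha => ?_) (by simp)
      by_contra h
      exact ha (exists_int_of_cirAut_term_ne_zero hy le_rfl (by omega) h).2
    have hneg : (q : ZMod (4*M-3)) - ((2*q : ℕ) : ZMod (4*M-3)) = -q := by
      push_cast
      ring
    have heven : (x + rev x) (-(q : ZMod (4*M-3))) = (x + rev x) q := by
      simp [rev, add_comm]
    have hyq : (x + rev x) (q : ZMod (4*M-3)) ≠ 0 := by
      rcases Nat.eq_zero_or_pos q with rfl | hpos
      · simpa [rev, ← two_mul] using hxq
      · have hcast : -(q : ZMod (4*M-3)) = ((4*M-3-q : ℕ) : ZMod (4*M-3)) := by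
          rw [Nat.cast_sub (by omega), ZMod.natCast_self, zero_sub]
        have h0 : x (-(q : ZMod (4*M-3))) = 0 := by
          rw [hcast]
          exact hsupp _ (by omega) (by omega)
        simpa [rev, h0] using hxq
    rw [hsum, hneg, heven]
    exact mul_ne_zero hyq (by simpa only [ne_eq, map_eq_zero] using hyq)
  · refine Finset.sum_eq_zero fun a _ => ?_
    by_contra h
    exact hp.ne' (exists_int_of_cirAut_term_ne_zero hy hp.le (by omega) h).1
end

section
/- Let Φ = {φ_n}_{n=1}^N ⊆ ℝ^M and define A : ℝ^M → ℝ^N by (A(x))(n) := |⟨x, φ_n⟩|². Then A is injective up to global sign (i.e., A(x) = A(y) implies y = x or y = −x) if and only if for every subset S ⊆ {1,…,N}, either {φ_n}_{n∈S} or {φ_n}_{n∈S^c} spans ℝ^M. -/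
open Finset RealInnerProductSpace

theorem span_eq_top_iff_forall_inner_eq_zero {E : Type*} [NormedAddCommGroup E]
    [InnerProductSpace ℝ E] [FiniteDimensional ℝ E] (s : Set E) :
    Submodule.span ℝ s = ⊤ ↔ ∀ u : E, (∀ v ∈ s, ⟪u, v⟫ = 0) → u = 0 := by
  rw [← Submodule.orthogonal_eq_bot_iff, Submodule.eq_bot_iff]
  have mem_orthogonal_iff (u : E) : u ∈ (Submodule.span ℝ s)ᗮ ↔ ∀ v ∈ s, ⟪u, v⟫ = 0 := by
    rw [Submodule.mem_orthogonal']
    refine ⟨fun h v hv => h v (Submodule.subset_span hv), fun h v hv => ?_⟩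
    induction hv using Submodule.span_induction with
    | mem v hv => exact h v hv
    | zero => exact inner_zero_right u
    | add v w _ _ hv hw => rw [inner_add_right, hv, hw, add_zero]
    | smul c v _ hv => rw [inner_smul_right, hv, mul_zero]
  simp only [mem_orthogonal_iff]

theorem complement_property_characterization (M N : ℕ)
    (Φ : Fin N → EuclideanSpace ℝ (Fin M)) :
    (∀ x y : EuclideanSpace ℝ (Fin M),
        (∀ n, |⟪x, Φ n⟫|^2 = |⟪y, Φ n⟫|^2) → y = x ∨ y = -x) ↔
    (∀ S : Finset (Fin N),
        Submodule.span ℝ (Φ '' ↑S) = ⊤ ∨ Submodule.span ℝ (Φ '' ↑Sᶜ) = ⊤) := by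
  simp only [span_eq_top_iff_forall_inner_eq_zero, Set.forall_mem_image, Finset.coe_compl,
    Set.mem_compl_iff, Finset.mem_coe, sq_abs, sq_eq_sq_iff_eq_or_eq_neg]
  have : IsAddTorsionFree (EuclideanSpace ℝ (Fin M)) := .of_module_rat _
  constructor
  · intro h S
    by_contra! hS
    obtain ⟨⟨u, hu, hu0⟩, v, hv, hv0⟩ := hS
    have heq (n : Fin N) :
        ⟪u + v, Φ n⟫ = ⟪u - v, Φ n⟫ ∨ ⟪u + v, Φ n⟫ = -⟪u - v, Φ n⟫ := by
      rw [inner_add_left, inner_sub_left]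
      by_cases hn : n ∈ S
      · simp [hu hn]
      · simp [hv hn]
    rcases h _ _ heq with huv | huv
    · rw [sub_eq_add_neg, add_right_inj] at huv
      exact hv0 (self_eq_neg.mp huv.symm)
    · rw [neg_add, sub_eq_add_neg, add_left_inj] at huv
      exact hu0 (self_eq_neg.mp huv)
  · intro h x y hxy
    rcases h {n | ⟪x, Φ n⟫ = ⟪y, Φ n⟫} with hS | hS
    · refine .inl (sub_eq_zero.mp (hS _ fun n hn => ?_))
      rw [inner_sub_left, (Finset.mem_filter.mp hn).2, sub_self]
    · refine .inr (eq_neg_of_add_eq_zero_left (hS _ fun n hn => ?_))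
      have hne : ⟪x, Φ n⟫ ≠ ⟪y, Φ n⟫ := by simpa using hn
      rw [inner_add_left, (hxy n).resolve_left hne, add_neg_cancel]
end

section
/- Let Φ = {φ_n}_{n=1}^N ⊆ ℝ^M and define A : ℝ^M → ℝ^N by (A(x))(n) := |⟨x, φ_n⟩|². For x ∈ ℝ^M, the fiber A⁻¹(A(x)) equals {x, −x} if and only if there is no subset S ⊆ {1,…,N} such that x lies in the Minkowski sum (span(Φ_S)^⊥ \ {0}) + (span(Φ_{S^c})^⊥ \ {0}), i.e., such that x = u + v with u a nonzero vector orthogonal to all φ_n with n ∈ S and v a nonzero vector orthogonal to all φ_n with n ∈ S^c. -/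
open Finset RealInnerProductSpace Pointwise

theorem mem_orthogonal_span_image_iff {ι E : Type*} [NormedAddCommGroup E]
    [InnerProductSpace ℝ E] (Φ : ι → E) (S : Set ι) (u : E) :
    u ∈ (Submodule.span ℝ (Φ '' S))ᗮ ↔ ∀ n ∈ S, ⟪u, Φ n⟫ = 0 := by
  rw [← Submodule.span_singleton_le_iff_mem, ← Submodule.isOrtho_iff_le, Submodule.isOrtho_span]
  simp

theorem fiber_characterization (M N : ℕ)
    (Φ : Fin N → EuclideanSpace ℝ (Fin M)) (x : EuclideanSpace ℝ (Fin M)) :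
    (∀ y : EuclideanSpace ℝ (Fin M),
        (∀ n, |⟪y, Φ n⟫|^2 = |⟪x, Φ n⟫|^2) → y = x ∨ y = -x) ↔
    ¬ ∃ S : Finset (Fin N),
        x ∈ ((↑(Submodule.span ℝ (Φ '' ↑S))ᗮ : Set (EuclideanSpace ℝ (Fin M))) \ {0}) +
            ((↑(Submodule.span ℝ (Φ '' ↑Sᶜ))ᗮ : Set (EuclideanSpace ℝ (Fin M))) \ {0}) := by
  constructor
  · rintro h ⟨S, u, ⟨hu, hu0⟩, v, ⟨hv, hv0⟩, rfl⟩
    rw [SetLike.mem_coe, mem_orthogonal_span_image_iff] at hu hv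
    rcases h (u - v) fun n => by
      by_cases hn : n ∈ S
      · simp [inner_add_left, inner_sub_left, hu n (by simpa using hn)]
      · simp [inner_add_left, inner_sub_left, hv n (by simpa using hn)] with h' | h'
    · refine hv0 (?_ : v = 0)
      linear_combination (norm := module) (-2⁻¹ : ℝ) • h'
    · refine hu0 (?_ : u = 0)
      linear_combination (norm := module) (2⁻¹ : ℝ) • h'
  · intro h y hy
    by_contra! hne
    refine h ⟨({n | ⟪y, Φ n⟫ = -⟪x, Φ n⟫} : Finset (Fin N)), (2⁻¹ : ℝ) • (x + y), ⟨?_, ?_⟩,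
      (2⁻¹ : ℝ) • (x - y), ⟨?_, ?_⟩, ?_⟩
    · rw [SetLike.mem_coe, mem_orthogonal_span_image_iff]
      intro n hn
      have hn' : ⟪y, Φ n⟫ = -⟪x, Φ n⟫ := by simpa using hn
      simp [inner_smul_left, inner_add_left, hn']
    · rw [Set.mem_singleton_iff, smul_eq_zero_iff_right (by norm_num), add_comm,
        add_eq_zero_iff_eq_neg]
      exact hne.2
    · rw [SetLike.mem_coe, mem_orthogonal_span_image_iff]
      intro n hn
      have hn' : ⟪y, Φ n⟫ ≠ -⟪x, Φ n⟫ := by simpa using hn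
      have hxy : ⟪y, Φ n⟫ = ⟪x, Φ n⟫ := by
        have := hy n
        rw [sq_abs, sq_abs] at this
        exact (sq_eq_sq_iff_eq_or_eq_neg.mp this).resolve_right hn'
      simp [inner_smul_left, inner_sub_left, hxy]
    · simpa [sub_eq_zero] using hne.1.symm
    · module
end

section
/- Let M, N be positive integers with gcd(M, N) = 1, and let Φ = {φ_n}_{n=1}^N ⊆ ℝ^M be a unit norm tight frame: ‖φ_n‖ = 1 for every n, and there is a constant A > 0 (necessarily A = N/M) such that Σ_{n=1}^N |⟨x, φ_n⟩|² = A·‖x‖² for all x ∈ ℝ^M. Then the intensity measurement map x ↦ (|⟨x, φ_n⟩|²)_{n=1}^N is almost injective: for Lebesgue-almost every x ∈ ℝ^M, the only vectors y ∈ ℝ^M with |⟨y, φ_n⟩| = |⟨x, φ_n⟩| for all n are y = ±x. -/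
open Finset RealInnerProductSpace MeasureTheory

section FrameOperator

open InnerProductSpace Module

variable {ι E : Type*} [NormedAddCommGroup E] [InnerProductSpace ℝ E]

/-- The frame operator `x ↦ ∑ n ∈ S, ⟪φ n, x⟫ • φ n` of the subfamily indexed by `S`. -/
noncomputable def frameOperator (φ : ι → E) (S : Finset ι) : E →ₗ[ℝ] E :=
  ∑ n ∈ S, (rankOne ℝ (φ n) (φ n)).toLinearMap

/-- The subspace of vectors orthogonal to every `φ n` with `n ∈ S`. -/
noncomputable def orthogonalTo (φ : ι → E) (S : Finset ι) : Submodule ℝ E :=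
  (Submodule.span ℝ (φ '' S))ᗮ

theorem frameOperator_apply (φ : ι → E) (S : Finset ι) (x : E) :
    frameOperator φ S x = ∑ n ∈ S, ⟪φ n, x⟫ • φ n := by
  simp [frameOperator, LinearMap.sum_apply]

theorem mem_orthogonalTo {φ : ι → E} {S : Finset ι} {x : E} :
    x ∈ orthogonalTo φ S ↔ ∀ n ∈ S, ⟪φ n, x⟫ = 0 := by
  rw [orthogonalTo, Submodule.mem_orthogonal]
  refine ⟨fun h n hn => h _ (Submodule.subset_span ⟨n, hn, rfl⟩), fun h u hu => ?_⟩
  induction hu using Submodule.span_induction with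
  | mem u hu => obtain ⟨n, hn, rfl⟩ := hu; exact h n hn
  | zero => simp
  | add u v _ _ hu hv => rw [inner_add_left, hu, hv, add_zero]
  | smul c u _ hu => rw [inner_smul_left, hu, mul_zero]

theorem frameOperator_apply_eq_zero {φ : ι → E} {S : Finset ι} {x : E}
    (hx : x ∈ orthogonalTo φ S) : frameOperator φ S x = 0 := by
  rw [frameOperator_apply]
  exact Finset.sum_eq_zero fun n hn => by rw [mem_orthogonalTo.1 hx n hn, zero_smul]

theorem trace_frameOperator [FiniteDimensional ℝ E] {φ : ι → E} (hnorm : ∀ n, ‖φ n‖ = 1)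
    (S : Finset ι) : LinearMap.trace ℝ E (frameOperator φ S) = S.card := by
  simp [frameOperator, map_sum, trace_rankOne, hnorm]

variable [Fintype ι]

theorem frameOperator_univ_eq_smul_id {φ : ι → E} {A : ℝ}
    (htight : ∀ x : E, ∑ n, |⟪x, φ n⟫| ^ 2 = A * ‖x‖ ^ 2) :
    frameOperator φ Finset.univ = A • LinearMap.id := by
  have hsymm : (frameOperator φ Finset.univ - A • LinearMap.id).IsSymmetric := by
    intro x y
    simp only [LinearMap.sub_apply, frameOperator_apply, LinearMap.smul_apply, LinearMap.id_apply,
      inner_sub_left, inner_sub_right, sum_inner, inner_sum, real_inner_smul_left,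
      real_inner_smul_right]
    congr 1
    exact Finset.sum_congr rfl fun n _ => by rw [real_inner_comm x (φ n)]; ring
  rw [← sub_eq_zero, ← hsymm.inner_map_self_eq_zero]
  intro x
  simp only [LinearMap.sub_apply, frameOperator_apply, LinearMap.smul_apply, LinearMap.id_apply,
    inner_sub_left, sum_inner, real_inner_smul_left, real_inner_self_eq_norm_sq]
  rw [← htight x, sub_eq_zero]
  exact Finset.sum_congr rfl fun n _ => by rw [sq_abs, real_inner_comm x (φ n), sq]

theorem eq_zero_of_forall_inner_eq_zero {φ : ι → E} {A : ℝ} (hA : 0 < A)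
    (htight : ∀ x : E, ∑ n, |⟪x, φ n⟫| ^ 2 = A * ‖x‖ ^ 2) {x : E}
    (hx : ∀ n, ⟪φ n, x⟫ = 0) : x = 0 := by
  have h := htight x
  simpa [real_inner_comm (φ _) x, hx, hA.ne'] using h

variable [DecidableEq ι]

theorem frameOperator_apply_of_mem_orthogonalTo_compl {φ : ι → E} {A : ℝ}
    (htight : ∀ x : E, ∑ n, |⟪x, φ n⟫| ^ 2 = A * ‖x‖ ^ 2) {S : Finset ι} {x : E}
    (hx : x ∈ orthogonalTo φ Sᶜ) : frameOperator φ S x = A • x := by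
  have h := congrArg (· x) (frameOperator_univ_eq_smul_id htight)
  have hc := frameOperator_apply_eq_zero hx
  simp only [frameOperator_apply, LinearMap.smul_apply, LinearMap.id_apply] at h hc ⊢
  rw [← h, ← Finset.sum_add_sum_compl S, hc, add_zero]

theorem card_eq_mul_finrank_of_sup_eq_top [FiniteDimensional ℝ E] {φ : ι → E}
    (hnorm : ∀ n, ‖φ n‖ = 1) {A : ℝ} (hA : 0 < A)
    (htight : ∀ x : E, ∑ n, |⟪x, φ n⟫| ^ 2 = A * ‖x‖ ^ 2) {S : Finset ι}
    (hS : orthogonalTo φ S ⊔ orthogonalTo φ Sᶜ = ⊤) :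
    (S.card : ℝ) = A * finrank ℝ (orthogonalTo φ Sᶜ) := by
  have hproj : LinearMap.IsProj (orthogonalTo φ Sᶜ) (A⁻¹ • frameOperator φ S) := by
    have hid : ∀ w ∈ orthogonalTo φ Sᶜ, (A⁻¹ • frameOperator φ S) w = w := fun w hw => by
      rw [LinearMap.smul_apply, frameOperator_apply_of_mem_orthogonalTo_compl htight hw,
        inv_smul_smul₀ hA.ne']
    refine ⟨fun x => ?_, hid⟩
    obtain ⟨u, hu, w, hw, rfl⟩ := Submodule.mem_sup.1 (hS ▸ Submodule.mem_top : x ∈ _)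
    rwa [map_add, hid w hw, LinearMap.smul_apply, frameOperator_apply_eq_zero hu, smul_zero,
      zero_add]
  rw [← hproj.trace, map_smul, trace_frameOperator hnorm, smul_eq_mul,
    mul_inv_cancel_left₀ hA.ne']

theorem eq_empty_or_eq_univ_of_sup_eq_top [FiniteDimensional ℝ E] {φ : ι → E}
    (hcop : Nat.Coprime (finrank ℝ E) (Fintype.card ι))
    (hnorm : ∀ n, ‖φ n‖ = 1) {A : ℝ} (hA : 0 < A)
    (htight : ∀ x : E, ∑ n, |⟪x, φ n⟫| ^ 2 = A * ‖x‖ ^ 2) {S : Finset ι}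
    (hS : orthogonalTo φ S ⊔ orthogonalTo φ Sᶜ = ⊤) : S = ∅ ∨ S = Finset.univ := by
  have hcard := card_eq_mul_finrank_of_sup_eq_top hnorm hA htight hS
  have htotal : (Fintype.card ι : ℝ) = A * finrank ℝ E := by
    rw [← Finset.card_univ, ← trace_frameOperator hnorm, frameOperator_univ_eq_smul_id htight,
      map_smul, LinearMap.trace_id, smul_eq_mul]
  have hle := (orthogonalTo φ Sᶜ).finrank_le
  set d := finrank ℝ (orthogonalTo φ Sᶜ)
  have hmul : finrank ℝ E * S.card = Fintype.card ι * d := by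
    have : (finrank ℝ E : ℝ) * S.card = Fintype.card ι * d := by rw [hcard, htotal]; ring
    exact_mod_cast this
  have hdvd : finrank ℝ E ∣ d := hcop.dvd_of_dvd_mul_left ⟨_, hmul.symm⟩
  rcases Nat.eq_zero_or_pos d with hd | hd
  · left
    rw [← Finset.card_eq_zero]
    simpa [hd] using hcard
  · right
    rw [← Finset.card_eq_iff_eq_univ]
    have hd' : d = finrank ℝ E := le_antisymm hle (Nat.le_of_dvd hd hdvd)
    rw [hd', ← htotal] at hcard
    exact_mod_cast hcard

end FrameOperator

theorem untf_coprime_almost_injective (M N : ℕ) (hM : 0 < M) (hN : 0 < N)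
    (hcop : Nat.Coprime M N)
    (Φ : Fin N → EuclideanSpace ℝ (Fin M))
    (hnorm : ∀ n, ‖Φ n‖ = 1)
    (htight : ∃ A : ℝ, 0 < A ∧
      ∀ x : EuclideanSpace ℝ (Fin M), ∑ n, |⟪x, Φ n⟫|^2 = A * ‖x‖^2) :
    ∀ᵐ x ∂(volume : Measure (EuclideanSpace ℝ (Fin M))),
      ∀ y : EuclideanSpace ℝ (Fin M),
        (∀ n, |⟪y, Φ n⟫| = |⟪x, Φ n⟫|) → y = x ∨ y = -x := by
  obtain ⟨A, hA, htight⟩ := htight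
  have hgeneric : ∀ᵐ x ∂(volume : Measure (EuclideanSpace ℝ (Fin M))),
      ∀ S : Finset (Fin N), orthogonalTo Φ S ⊔ orthogonalTo Φ Sᶜ ≠ ⊤ →
        x ∉ orthogonalTo Φ S ⊔ orthogonalTo Φ Sᶜ := by
    refine ae_all_iff.2 fun S => ?_
    by_cases hS : orthogonalTo Φ S ⊔ orthogonalTo Φ Sᶜ = ⊤
    · exact .of_forall fun x h => absurd hS h
    · filter_upwards [measure_eq_zero_iff_ae_notMem.1 (Measure.addHaar_submodule volume _ hS)]
        with x hx _ using hx
  filter_upwards [hgeneric] with x hx y hy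
  set S : Finset (Fin N) := {n | ⟪Φ n, y⟫ = ⟪Φ n, x⟫} with hSdef
  have hmem : ∀ n ∈ S, ⟪Φ n, x - y⟫ = 0 := fun n hn => by
    rw [inner_sub_right, (mem_filter.1 hn).2, sub_self]
  have hmemc : ∀ n ∈ Sᶜ, ⟪Φ n, x + y⟫ = 0 := fun n hn => by
    have hne : ⟪Φ n, y⟫ ≠ ⟪Φ n, x⟫ := by simpa [hSdef] using hn
    have habs := hy n
    rw [real_inner_comm (Φ n) y, real_inner_comm (Φ n) x] at habs
    rw [inner_add_right, (abs_eq_abs.1 habs).resolve_left hne, add_neg_cancel]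
  have hxmem : x ∈ orthogonalTo Φ S ⊔ orthogonalTo Φ Sᶜ := by
    have hsplit : x = (2⁻¹ : ℝ) • (x - y) + (2⁻¹ : ℝ) • (x + y) := by module
    rw [hsplit]
    exact Submodule.add_mem_sup (Submodule.smul_mem _ _ (mem_orthogonalTo.2 hmem))
      (Submodule.smul_mem _ _ (mem_orthogonalTo.2 hmemc))
  have htop : orthogonalTo Φ S ⊔ orthogonalTo Φ Sᶜ = ⊤ := not_not.1 fun h => hx S h hxmem
  rcases eq_empty_or_eq_univ_of_sup_eq_top (by simpa using hcop) hnorm hA htight htop with h | h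
  · right
    have := eq_zero_of_forall_inner_eq_zero hA htight fun n => hmemc n (by simp [h])
    exact eq_neg_of_add_eq_zero_right this
  · left
    have := eq_zero_of_forall_inner_eq_zero hA htight fun n => hmem n (by simp [h])
    exact (sub_eq_zero.1 this).symm
end

section
/- Let Φ = {φ_n}_{n=1}^N ⊆ ℝ^M with N ≥ M+1 be full spark, meaning every subcollection of M of the vectors φ_n spans ℝ^M. Then the intensity measurement map x ↦ (|⟨x, φ_n⟩|²)_{n=1}^N is almost injective: for Lebesgue-almost every x ∈ ℝ^M, the only vectors y with |⟨y, φ_n⟩| = |⟨x, φ_n⟩| for all n are y = ±x. -/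
open Finset RealInnerProductSpace MeasureTheory

/-- In a full spark ensemble, at most `M` vectors span a subspace whose dimension is at least
their number. -/
theorem card_le_finrank_span_of_full_spark {M N : ℕ} (hN : M ≤ N)
    (Φ : Fin N → EuclideanSpace ℝ (Fin M))
    (hfs : ∀ S : Finset (Fin N), S.card = M → Submodule.span ℝ (Φ '' ↑S) = ⊤)
    (S : Finset (Fin N)) (hS : S.card ≤ M) :
    S.card ≤ Module.finrank ℝ (Submodule.span ℝ (Φ '' ↑S)) := by
  classical
  obtain ⟨T, hST, hT⟩ := Finset.exists_superset_card_eq hS (by simpa using hN)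
  have hle := Submodule.finrank_add_le_finrank_add_finrank
    (Submodule.span ℝ (Φ '' ↑S)) (Submodule.span ℝ (Φ '' ↑(T \ S)))
  rw [← Submodule.span_union, ← Set.image_union, ← Finset.coe_union,
    Finset.union_sdiff_of_subset hST, hfs T hT, finrank_top, finrank_euclideanSpace_fin] at hle
  have hcard : Module.finrank ℝ (Submodule.span ℝ (Φ '' ↑(T \ S))) ≤ (T \ S).card := by
    rw [← Finset.coe_image]
    exact (finrank_span_finset_le_card _).trans Finset.card_image_le
  have := Finset.card_sdiff_add_card_eq_card hST
  omega

theorem span_eq_top_of_full_spark {M N : ℕ} (Φ : Fin N → EuclideanSpace ℝ (Fin M))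
    (hfs : ∀ S : Finset (Fin N), S.card = M → Submodule.span ℝ (Φ '' ↑S) = ⊤)
    (S : Finset (Fin N)) (hS : M ≤ S.card) : Submodule.span ℝ (Φ '' ↑S) = ⊤ := by
  obtain ⟨T, hTS, hT⟩ := Finset.exists_subset_card_eq hS
  exact top_unique ((hfs T hT).ge.trans
    (Submodule.span_mono (Set.image_mono (Finset.coe_subset.2 hTS))))

theorem orthogonal_sup_orthogonal_compl_ne_top_of_full_spark {M N : ℕ} (hN : M + 1 ≤ N)
    (Φ : Fin N → EuclideanSpace ℝ (Fin M))
    (hfs : ∀ S : Finset (Fin N), S.card = M → Submodule.span ℝ (Φ '' ↑S) = ⊤)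
    (S : Finset (Fin N)) (hS : S.card ≤ M) (hSc : Sᶜ.card ≤ M) :
    (Submodule.span ℝ (Φ '' ↑S))ᗮ ⊔ (Submodule.span ℝ (Φ '' ↑Sᶜ))ᗮ ≠ ⊤ := by
  intro htop
  have hle := Submodule.finrank_add_le_finrank_add_finrank
    (Submodule.span ℝ (Φ '' ↑S))ᗮ (Submodule.span ℝ (Φ '' ↑Sᶜ))ᗮ
  rw [htop, finrank_top, finrank_euclideanSpace_fin] at hle
  have h₁ := (Submodule.span ℝ (Φ '' ↑S)).finrank_add_finrank_orthogonal
  have h₂ := (Submodule.span ℝ (Φ '' ↑Sᶜ)).finrank_add_finrank_orthogonal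
  rw [finrank_euclideanSpace_fin] at h₁ h₂
  have h₃ := card_le_finrank_span_of_full_spark (by omega) Φ hfs S hS
  have h₄ := card_le_finrank_span_of_full_spark (by omega) Φ hfs Sᶜ hSc
  have h₅ := Finset.card_add_card_compl S
  rw [Fintype.card_fin] at h₅
  omega

theorem mem_orthogonal_span_image {E ι : Type*} [NormedAddCommGroup E] [InnerProductSpace ℝ E]
    {Φ : ι → E} {S : Set ι} {v : E} (h : ∀ n ∈ S, ⟪v, Φ n⟫ = 0) :
    v ∈ (Submodule.span ℝ (Φ '' S))ᗮ := by
  rw [Submodule.mem_orthogonal']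
  intro u hu
  induction hu using Submodule.span_induction with
  | mem u hu => obtain ⟨n, hn, rfl⟩ := hu; exact h n hn
  | zero => exact inner_zero_right v
  | add u w _ _ hu hw => rw [inner_add_right, hu, hw, add_zero]
  | smul c u _ hu => rw [inner_smul_right, hu, mul_zero]

theorem full_spark_almost_injective (M N : ℕ) (hN : M + 1 ≤ N)
    (Φ : Fin N → EuclideanSpace ℝ (Fin M))
    (hfs : ∀ S : Finset (Fin N), S.card = M → Submodule.span ℝ (Φ '' ↑S) = ⊤) :
    ∀ᵐ x ∂(volume : Measure (EuclideanSpace ℝ (Fin M))),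
      ∀ y : EuclideanSpace ℝ (Fin M),
        (∀ n, |⟪y, Φ n⟫| = |⟪x, Φ n⟫|) → y = x ∨ y = -x := by
  classical
  have hae : ∀ᵐ x ∂(volume : Measure (EuclideanSpace ℝ (Fin M))),
      ∀ S : Finset (Fin N), S.card ≤ M → Sᶜ.card ≤ M →
        x ∉ (Submodule.span ℝ (Φ '' ↑S))ᗮ ⊔ (Submodule.span ℝ (Φ '' ↑Sᶜ))ᗮ := by
    simp only [ae_all_iff]
    intro S hS hSc
    exact measure_eq_zero_iff_ae_notMem.1 (Measure.addHaar_submodule _ _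
      (orthogonal_sup_orthogonal_compl_ne_top_of_full_spark hN Φ hfs S hS hSc))
  filter_upwards [hae] with x hx y hy
  set S : Finset (Fin N) := {n | ⟪y, Φ n⟫ = ⟪x, Φ n⟫} with hSdef
  have hsub : y - x ∈ (Submodule.span ℝ (Φ '' ↑S))ᗮ := by
    refine mem_orthogonal_span_image fun n hn => ?_
    have hn' : ⟪y, Φ n⟫ = ⟪x, Φ n⟫ := by simpa [hSdef] using hn
    rw [inner_sub_left, hn', sub_self]
  have hadd : y + x ∈ (Submodule.span ℝ (Φ '' ↑Sᶜ))ᗮ := by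
    refine mem_orthogonal_span_image fun n hn => ?_
    have hn' : ¬ ⟪y, Φ n⟫ = ⟪x, Φ n⟫ := by simpa [hSdef] using hn
    rw [inner_add_left, (abs_eq_abs.1 (hy n)).resolve_left hn', neg_add_cancel]
  by_cases hS : M ≤ S.card
  · rw [span_eq_top_of_full_spark Φ hfs S hS, Submodule.top_orthogonal_eq_bot,
      Submodule.mem_bot, sub_eq_zero] at hsub
    exact Or.inl hsub
  by_cases hSc : M ≤ Sᶜ.card
  · rw [span_eq_top_of_full_spark Φ hfs Sᶜ hSc, Submodule.top_orthogonal_eq_bot,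
      Submodule.mem_bot, add_eq_zero_iff_eq_neg] at hadd
    exact Or.inr hadd
  refine absurd ?_ (hx S (by omega) (by omega))
  have hx_eq : x = (-(1 / 2 : ℝ)) • (y - x) + (1 / 2 : ℝ) • (y + x) := by module
  rw [hx_eq]
  exact Submodule.add_mem_sup (Submodule.smul_mem _ _ hsub) (Submodule.smul_mem _ _ hadd)
end

section
/- Let M ≥ 2 and let Φ = {φ_n}_{n=1}^{M+1} ⊆ ℝ^M be full spark. Let Ψ be the invertible M×M matrix with columns φ_1, …, φ_M, and let w ∈ ℝ^M be the (entrywise nonzero) vector with Ψ w = φ_{M+1}. Given integers a_1, …, a_M and z, define b_n := |a_n / w_n| for n = 1, …, M and b_{M+1} := |2z − Σ_{m=1}^M a_m|. Then there exists x ∈ ℝ^M with |⟨x, φ_n⟩| = b_n for every n = 1, …, M+1 if and only if there exists a subset S ⊆ {1,…,M} with Σ_{m∈S} a_m = z. -/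
open Finset RealInnerProductSpace

/-- A spanning family of `dim E` vectors admits a vector with prescribed inner products. -/
theorem exists_inner_eq_of_span_eq_top {ι E : Type*} [Fintype ι] [NormedAddCommGroup E]
    [InnerProductSpace ℝ E] [FiniteDimensional ℝ E] (v : ι → E)
    (hspan : Submodule.span ℝ (Set.range v) = ⊤)
    (hcard : Fintype.card ι = Module.finrank ℝ E) (c : ι → ℝ) :
    ∃ x : E, ∀ i, ⟪x, v i⟫ = c i := by
  have : CompleteSpace E := FiniteDimensional.complete ℝ E
  let b := Module.Basis.mk (linearIndependent_of_top_le_span_of_card_eq_finrank hspan.ge hcard)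
    hspan.ge
  refine ⟨(InnerProductSpace.toDual ℝ E).symm (b.constr ℝ c).toContinuousLinearMap, fun i => ?_⟩
  rw [InnerProductSpace.toDual_symm_apply]
  have hb : b i = v i := by simp [b]
  rw [← hb]
  simpa using b.constr_basis ℝ c i

/-- A signed sum, with signs positive exactly on `S`. -/
theorem sum_ite_neg_eq_two_mul_sum_sub {ι R : Type*} [Fintype ι] [DecidableEq ι] [CommRing R]
    (S : Finset ι) (a : ι → R) :
    ∑ i, (if i ∈ S then a i else -a i) = 2 * ∑ i ∈ S, a i - ∑ i, a i := by
  have h : ∀ i, (if i ∈ S then a i else -a i) = 2 * (if i ∈ S then a i else 0) - a i := by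
    intro i
    split_ifs <;> ring
  simp_rw [h]
  rw [Finset.sum_sub_distrib, ← Finset.mul_sum, Finset.sum_ite_mem, Finset.univ_inter]

theorem subset_sum_reduction (M : ℕ) (hM : 2 ≤ M)
    (Φ : Fin (M+1) → EuclideanSpace ℝ (Fin M))
    (hfs : ∀ S : Finset (Fin (M+1)), S.card = M → Submodule.span ℝ (Φ '' ↑S) = ⊤)
    (w : Fin M → ℝ)
    (hw : ∑ m : Fin M, w m • Φ m.castSucc = Φ (Fin.last M))
    (hwne : ∀ m, w m ≠ 0)
    (a : Fin M → ℤ) (z : ℤ) :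
    (∃ x : EuclideanSpace ℝ (Fin M),
        (∀ m : Fin M, |⟪x, Φ m.castSucc⟫| = |(a m : ℝ) / w m|) ∧
        |⟪x, Φ (Fin.last M)⟫| = |2 * (z : ℝ) - ∑ m : Fin M, (a m : ℝ)|) ↔
    (∃ S : Finset (Fin M), ∑ m ∈ S, a m = z) := by
  classical
  have hlast : ∀ (x : EuclideanSpace ℝ (Fin M)) (S : Finset (Fin M)),
      (∀ m, w m * ⟪x, Φ m.castSucc⟫ = if m ∈ S then (a m : ℝ) else -a m) →
      ⟪x, Φ (Fin.last M)⟫ = 2 * ∑ m ∈ S, (a m : ℝ) - ∑ m, (a m : ℝ) := by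
    intro x S h
    rw [← hw, inner_sum, ← sum_ite_neg_eq_two_mul_sum_sub]
    exact Finset.sum_congr rfl fun m _ => by rw [real_inner_smul_right, h m]
  constructor
  · rintro ⟨x, hx, hxl⟩
    let S : Finset (Fin M) := {m | w m * ⟪x, Φ m.castSucc⟫ = a m}
    rw [hlast x S] at hxl
    · rcases abs_eq_abs.mp hxl with h | h
      · refine ⟨S, ?_⟩
        have : ∑ m ∈ S, (a m : ℝ) = z := by linarith
        exact_mod_cast this
      · refine ⟨Sᶜ, ?_⟩
        have hc := Finset.sum_add_sum_compl S fun m => (a m : ℝ)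
        have : ∑ m ∈ Sᶜ, (a m : ℝ) = z := by linarith
        exact_mod_cast this
    · intro m
      split_ifs with hm
      · simpa [S] using hm
      · have hm' : w m * ⟪x, Φ m.castSucc⟫ ≠ a m := by simpa [S] using hm
        have hwm := hwne m
        rcases abs_eq_abs.mp (hx m) with h | h
        · exact absurd (by rw [h]; field_simp) hm'
        · rw [h]; field_simp
  · rintro ⟨S, rfl⟩
    have hspan : Submodule.span ℝ (Set.range fun m : Fin M => Φ m.castSucc) = ⊤ := by
      rw [← hfs (Finset.univ.map Fin.castSuccEmb) (by simp), Finset.coe_map,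
        ← Set.image_comp, Finset.coe_univ, Set.image_univ]
      rfl
    obtain ⟨x, hx⟩ := exists_inner_eq_of_span_eq_top _ hspan (by simp)
      fun m => (if m ∈ S then (a m : ℝ) else -a m) / w m
    refine ⟨x, fun m => ?_, ?_⟩
    · rw [hx m, abs_div, abs_div]
      split_ifs <;> simp
    · rw [hlast x S fun m => by rw [hx m, mul_div_cancel₀ _ (hwne m)]]
      push_cast
      rfl
end

section
/- Let M ≥ 2, let Φ = {φ_n}_{n=1}^{M+1} ⊆ ℚ^M ⊆ ℝ^M be a full spark ensemble with rational entries, and let b_1, …, b_{M+1} be rational numbers. If x ∈ ℝ^M satisfies |⟨x, φ_n⟩| = b_n for every n = 1, …, M+1, then every entry of x is rational. -/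
open Finset RealInnerProductSpace

/-- Two vectors with the same inner products against a spanning set are equal. -/
lemma eq_of_inner_eq_of_span_eq_top {E : Type*} [NormedAddCommGroup E] [InnerProductSpace ℝ E]
    {s : Set E} (hs : Submodule.span ℝ s = ⊤) {x y : E} (h : ∀ v ∈ s, ⟪x, v⟫ = ⟪y, v⟫) :
    x = y := by
  refine ext_inner_right ℝ fun v => ?_
  have hv : v ∈ Submodule.span ℝ s := hs ▸ Submodule.mem_top
  induction hv using Submodule.span_induction with
  | mem v hv => exact h v hv
  | zero => simp
  | add u v _ _ hu hv => rw [inner_add_right, inner_add_right, hu, hv]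
  | smul a v _ hv => rw [inner_smul_right, inner_smul_right, hv]

/-- A vector having rational inner products with `n` rational vectors that span `ℝⁿ` is
rational. -/
lemma rational_of_inner_rational {ι : Type*} [Fintype ι]
    {f : ι → EuclideanSpace ℝ ι} (q : Matrix ι ι ℚ) (hq : ∀ i j, f i j = (q i j : ℝ))
    (hspan : Submodule.span ℝ (Set.range f) = ⊤)
    {x : EuclideanSpace ℝ ι} (v : ι → ℚ) (hv : ∀ i, ⟪x, f i⟫ = (v i : ℝ)) (j : ι) :
    ∃ r : ℚ, x j = (r : ℝ) := by
  classical
  let c : (ι → ℚ) → EuclideanSpace ℝ ι := fun y => WithLp.toLp 2 fun k => (y k : ℝ)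
  have hc (y : ι → ℚ) (i : ι) : ⟪c y, f i⟫ = (q.mulVec y i : ℝ) := by
    simp [c, PiLp.inner_apply, Matrix.mulVec, dotProduct, hq]
  have hinj : Function.Injective q.mulVec := fun y z hyz => by
    have h : c y = c z := by
      refine eq_of_inner_eq_of_span_eq_top hspan ?_
      rintro _ ⟨i, rfl⟩
      rw [hc, hc, hyz]
    funext k
    have hk : (y k : ℝ) = z k := congrArg (fun w : EuclideanSpace ℝ ι => w k) h
    exact_mod_cast hk
  obtain ⟨y, hy⟩ := (Matrix.mulVec_surjective_iff_isUnit.mpr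
    (Matrix.mulVec_injective_iff_isUnit.mp hinj)) v
  have hxy : x = c y := by
    refine eq_of_inner_eq_of_span_eq_top hspan ?_
    rintro _ ⟨i, rfl⟩
    rw [hv, hc, hy]
  exact ⟨y j, by rw [hxy]⟩

theorem rational_certificate (M : ℕ) (hM : 2 ≤ M)
    (Φ : Fin (M+1) → EuclideanSpace ℝ (Fin M))
    (hrat : ∀ n : Fin (M+1), ∀ p : Fin M, ∃ r : ℚ, Φ n p = (r : ℝ))
    (hfs : ∀ S : Finset (Fin (M+1)), S.card = M → Submodule.span ℝ (Φ '' ↑S) = ⊤)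
    (b : Fin (M+1) → ℚ)
    (x : EuclideanSpace ℝ (Fin M))
    (hx : ∀ n, |⟪x, Φ n⟫| = (b n : ℝ)) :
    ∀ p : Fin M, ∃ r : ℚ, x p = (r : ℝ) := by
  choose q hq using hrat
  have hv (n : Fin (M+1)) : ∃ r : ℚ, ⟪x, Φ n⟫ = (r : ℝ) := by
    rcases abs_choice ⟪x, Φ n⟫ with h | h
    · exact ⟨b n, by rw [← hx n, h]⟩
    · exact ⟨-b n, by push_cast; rw [← hx n, h, neg_neg]⟩
  choose v hv using hv
  have hspan : Submodule.span ℝ (Set.range fun i : Fin M => Φ i.castSucc) = ⊤ := by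
    have h := hfs (univ.map Fin.castSuccEmb) (by simp)
    rwa [coe_map, coe_univ, Set.image_univ, ← Set.range_comp] at h
  exact rational_of_inner_rational (fun i => q i.castSucc) (fun i => hq i.castSucc) hspan
    (fun i => v i.castSucc) fun i => hv i.castSucc
end
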